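/- arXiv:1910.04260 — 2 statements merged into one kernel-verified Lean document; each statement's English description precedes it below -/
import Mathlib

section
/- The lower bound on worst-case regret holds already with fixed costs: for every policy ρ, the supremum of the regret RGRT over all inverse-demand functions V, all fixed cost functions C (i.e., cost functions with C(q) constant for q > 0), and all firm's best responses (q,p) to (V,C) under ρ, is at least r_α. -/
open Real Set MeasureTheory

noncomputable section

/-- `V` is an inverse-demand function: antitone, upper-semicontinuous, with values in `[0, vbar]`. -/
def IsDemand (vbar : ℝ) (V : ℝ → ℝ) : Prop :=
  AntitoneOn V (Icc 0 1) ∧ UpperSemicontinuousOn V (Icc 0 1) ∧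
    ∀ z ∈ Icc (0:ℝ) 1, V z ∈ Icc 0 vbar

/-- `C` is a cost function: monotone increasing, lower-semicontinuous, nonnegative, `C 0 = 0`. -/
def IsCost (C : ℝ → ℝ) : Prop :=
  MonotoneOn C (Icc 0 1) ∧ LowerSemicontinuousOn C (Icc 0 1) ∧
    (∀ z ∈ Icc (0:ℝ) 1, 0 ≤ C z) ∧ C 0 = 0

/-- `(q, p)` is feasible under the inverse-demand function `V`. -/
def Feasible (vbar : ℝ) (V : ℝ → ℝ) (q p : ℝ) : Prop :=
  q ∈ Icc (0:ℝ) 1 ∧ p ∈ Icc (0:ℝ) vbar ∧ p ≤ V q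

/-- The social optimum `OPT(V, C)`. -/
def OPT (V C : ℝ → ℝ) : ℝ :=
  sSup { x | ∃ q ∈ Icc (0:ℝ) 1, x = (∫ z in (0:ℝ)..q, V z) - C q }

/-- `ρ` is a policy: upper-semicontinuous with `ρ 0 0 ≥ 0`. -/
def IsPolicy (vbar : ℝ) (ρ : ℝ → ℝ → ℝ) : Prop :=
  UpperSemicontinuousOn (fun x : ℝ × ℝ => ρ x.1 x.2) (Icc 0 1 ×ˢ Icc 0 vbar) ∧ 0 ≤ ρ 0 0

/-- `(q, p)` is a firm's best response to `(V, C)` under the policy `ρ`. -/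
def BestResponse (vbar : ℝ) (V C : ℝ → ℝ) (ρ : ℝ → ℝ → ℝ) (q p : ℝ) : Prop :=
  Feasible vbar V q p ∧
    ∀ q' p', Feasible vbar V q' p' → ρ q' p' - C q' ≤ ρ q p - C q

/-- The regret `RGRT = DSTR + (1 - α) * FP`. -/
def RGRT (vbar α : ℝ) (V C : ℝ → ℝ) (ρ : ℝ → ℝ → ℝ) (q p : ℝ) : ℝ :=
  (OPT V C - ((∫ z in (0:ℝ)..q, V z) - C q)) + (1 - α) * (ρ q p - C q)

/-- The worst-case regret of a policy `ρ` (as an extended real, since the supremum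
ranges over all demand/cost scenarios and best responses). -/
def WCR (vbar α : ℝ) (ρ : ℝ → ℝ → ℝ) : EReal :=
  sSup { r : EReal | ∃ V C q p, IsDemand vbar V ∧ IsCost C ∧
    BestResponse vbar V C ρ q p ∧ r = ((RGRT vbar α V C ρ q p : ℝ) : EReal) }

/-- The price-cap level `k_α = v̄ / (2 - α)`. -/
def kcap (vbar α : ℝ) : ℝ := vbar / (2 - α)

/-- The objective `min((1-α) q k_α - q p log q, q (k_α - p))`.
(Note `Real.log 0 = 0`, so `q * p * log q` is `0` at `q = 0` as required.) -/
def regretFn (vbar α q p : ℝ) : ℝ :=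
  min ((1 - α) * q * kcap vbar α - q * p * Real.log q) (q * (kcap vbar α - p))

/-- The lower bound `r_α` on the worst-case regret. -/
def rbound (vbar α : ℝ) : ℝ :=
  sSup { x | ∃ q ∈ Icc (0:ℝ) 1, ∃ p ∈ Icc (0:ℝ) (kcap vbar α), x = regretFn vbar α q p }

/-- The subsidy level `s_α`. (`Real.sSup ∅ = 0`, matching the convention for the empty set.) -/
def sbound (vbar α : ℝ) : ℝ :=
  sSup { x | ∃ q ∈ Icc (0:ℝ) 1, ∃ p ∈ Icc (0:ℝ) (kcap vbar α),
    (1 - α) * q * kcap vbar α - q * p * Real.log q > rbound vbar α ∧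
      x = q * (kcap vbar α - p) }


/-- `C` is a fixed cost function: a cost function which is constant on `(0, 1]`. -/
def IsFixedCost (C : ℝ → ℝ) : Prop :=
  IsCost C ∧ ∀ q ∈ Ioc (0:ℝ) 1, ∀ q' ∈ Ioc (0:ℝ) 1, C q = C q'

/-- The worst-case regret of `rho` when the supremum ranges only over fixed cost functions. -/
def WCRfixed (vbar alpha : ℝ) (ρ : ℝ → ℝ → ℝ) : EReal :=
  sSup { r : EReal | ∃ V C q p, IsDemand vbar V ∧ IsFixedCost C ∧
    BestResponse vbar V C ρ q p ∧ r = ((RGRT vbar alpha V C ρ q p : ℝ) : EReal) }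

theorem upperSemicontinuous_ite_le {q a : ℝ} {g : ℝ → ℝ}
    (hg : UpperSemicontinuousOn g (Ioi q)) (hga : ∀ z, q < z → g z ≤ a) :
    UpperSemicontinuous fun z => if z ≤ q then a else g z := by
  intro z y hy
  rcases le_or_gt z q with hz | hz
  · simp only [if_pos hz] at hy
    refine Filter.Eventually.of_forall fun w => ?_
    dsimp only
    split_ifs with hw
    · exact hy
    · exact (hga w (not_le.mp hw)).trans_lt hy
  · simp only [if_neg (not_le.mpr hz)] at hy
    have h := hg z hz y hy
    rw [isOpen_Ioi.nhdsWithin_eq hz] at h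
    filter_upwards [h, isOpen_Ioi.mem_nhds hz] with w hw hwq
    simpa only [if_neg (not_le.mpr (mem_Ioi.mp hwq))] using hw

/-- The demand equal to `vbar` up to quantity `q`, with constant revenue `q * p` afterwards. -/
def hyperbolicDemand (vbar q p z : ℝ) : ℝ := if z ≤ q then vbar else p * q / z

theorem isDemand_hyperbolicDemand {vbar q p : ℝ} (hq : 0 ≤ q) (hp : 0 ≤ p) (hpv : p ≤ vbar) :
    IsDemand vbar (hyperbolicDemand vbar q p) := by
  have hle : ∀ z, q < z → p * q / z ≤ vbar := fun z hz => by
    rw [div_le_iff₀ (hq.trans_lt hz)]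
    nlinarith
  refine ⟨?_, ?_, ?_⟩
  · intro x hx y hy hxy
    unfold hyperbolicDemand
    split_ifs with hyq hxq hxq
    · exact le_rfl
    · exact absurd (hxy.trans hyq) hxq
    · exact hle y (not_le.mp hyq)
    · exact div_le_div_of_nonneg_left (mul_nonneg hp hq) (hq.trans_lt (not_le.mp hxq)) hxy
  · refine UpperSemicontinuous.upperSemicontinuousOn
      (upperSemicontinuous_ite_le (ContinuousOn.upperSemicontinuousOn ?_) hle) _
    exact continuousOn_const.div continuousOn_id fun z hz => (hq.trans_lt hz).ne'
  · intro z hz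
    unfold hyperbolicDemand
    split_ifs with hzq
    · exact ⟨hp.trans hpv, le_rfl⟩
    · exact ⟨div_nonneg (mul_nonneg hp hq) hz.1, hle z (not_le.mp hzq)⟩

/-- The demand equal to `p` on `(0, q]` and to `0` beyond `q`, with choke price `vbar` at `0`. -/
def stepDemand (vbar q p z : ℝ) : ℝ := if z ≤ 0 then vbar else if z ≤ q then p else 0

theorem isDemand_stepDemand {vbar q p : ℝ} (hp : 0 ≤ p) (hpv : p ≤ vbar) :
    IsDemand vbar (stepDemand vbar q p) := by
  refine ⟨?_, ?_, ?_⟩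
  · intro x hx y hy hxy
    unfold stepDemand
    split_ifs <;> linarith
  · refine UpperSemicontinuous.upperSemicontinuousOn
      (upperSemicontinuous_ite_le (UpperSemicontinuous.upperSemicontinuousOn
        (upperSemicontinuous_ite_le upperSemicontinuousOn_const fun _ _ => hp) _) ?_) _
    intro z _
    split_ifs <;> linarith
  · intro z hz
    unfold stepDemand
    split_ifs <;> constructor <;> linarith

/-- The fixed cost function with fixed cost `c`. -/
def fixedCost (c : ℝ) : ℝ → ℝ := (Ioi (0:ℝ)).indicator fun _ => c

theorem fixedCost_zero (c : ℝ) : fixedCost c 0 = 0 := by simp [fixedCost]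

theorem fixedCost_of_pos {c z : ℝ} (hz : 0 < z) : fixedCost c z = c := by simp [fixedCost, hz]

theorem isFixedCost_fixedCost {c : ℝ} (hc : 0 ≤ c) : IsFixedCost (fixedCost c) := by
  refine ⟨⟨?_, ?_, fun z _ => indicator_nonneg (fun _ _ => hc) z, fixedCost_zero c⟩, ?_⟩
  · intro x hx y hy hxy
    rcases hx.1.eq_or_lt with rfl | h0
    · rw [fixedCost_zero]
      exact indicator_nonneg (fun _ _ => hc) y
    · rw [fixedCost_of_pos h0, fixedCost_of_pos (h0.trans_le hxy)]
  · exact (isOpen_Ioi.lowerSemicontinuous_indicator hc).lowerSemicontinuousOn _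
  · intro x hx y hy
    rw [fixedCost_of_pos hx.1, fixedCost_of_pos hy.1]

theorem integral_le_of_forall_mem_Icc {V : ℝ → ℝ} {a q : ℝ} (hq : 0 ≤ q)
    (hV : ∀ z ∈ Ioc 0 q, V z ∈ Icc 0 a) : ∫ z in (0:ℝ)..q, V z ≤ a * q := by
  have h := intervalIntegral.norm_integral_le_of_norm_le_const (a := 0) (b := q) (C := a) (f := V)
    fun z hz => by
      rw [uIoc_of_le hq] at hz
      rw [Real.norm_of_nonneg (hV z hz).1]
      exact (hV z hz).2
  rw [sub_zero, abs_of_nonneg hq] at h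
  exact (le_abs_self _).trans h

theorem surplus_le_OPT {vbar : ℝ} {V C : ℝ → ℝ} (hV : IsDemand vbar V) (hC : IsCost C)
    {q : ℝ} (hq : q ∈ Icc (0:ℝ) 1) : (∫ z in (0:ℝ)..q, V z) - C q ≤ OPT V C := by
  refine le_csSup ⟨vbar, ?_⟩ ⟨q, hq, rfl⟩
  rintro _ ⟨x, hx, rfl⟩
  have h := integral_le_of_forall_mem_Icc (V := V) (a := vbar) hx.1
    fun z hz => hV.2.2 z ⟨hz.1.le, hz.2.trans hx.2⟩
  have h0 := hV.2.2 0 ⟨le_rfl, zero_le_one⟩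
  nlinarith [hC.2.2.1 x hx, hx.2, h0.1.trans h0.2]

theorem integral_hyperbolicDemand {vbar q p : ℝ} (hq : q ∈ Icc (0:ℝ) 1) (hp : 0 ≤ p)
    (hpv : p ≤ vbar) :
    ∫ z in (0:ℝ)..1, hyperbolicDemand vbar q p z = q * vbar - q * p * Real.log q := by
  have hD := (isDemand_hyperbolicDemand hq.1 hp hpv).1
  have hi : ∀ a ∈ Icc (0:ℝ) 1, ∀ b ∈ Icc (0:ℝ) 1,
      IntervalIntegrable (hyperbolicDemand vbar q p) volume a b := fun a ha b hb =>
    (hD.mono (uIcc_subset_Icc ha hb)).intervalIntegrable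
  rw [← intervalIntegral.integral_add_adjacent_intervals
    (hi 0 ⟨le_rfl, zero_le_one⟩ q hq) (hi q hq 1 ⟨zero_le_one, le_rfl⟩)]
  have h1 : ∫ z in (0:ℝ)..q, hyperbolicDemand vbar q p z = q * vbar := by
    rw [intervalIntegral.integral_congr (g := fun _ => vbar)]
    · simp
    · intro z hz
      rw [uIcc_of_le hq.1] at hz
      exact if_pos hz.2
  have h2 : ∫ z in q..1, hyperbolicDemand vbar q p z = ∫ z in q..1, p * q * z⁻¹ := by
    refine intervalIntegral.integral_congr_ae (ae_of_all _ fun z hz => ?_)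
    rw [uIoc_of_le hq.2] at hz
    rw [hyperbolicDemand, if_neg (not_le.mpr hz.1), div_eq_mul_inv]
  rw [h1, h2, intervalIntegral.integral_const_mul]
  rcases hq.1.eq_or_lt with rfl | h0
  · simp
  · rw [integral_inv_of_pos h0 one_pos, one_div, Real.log_inv]
    ring

theorem setOf_feasible_hyperbolicDemand {vbar q p : ℝ} (hq : 0 ≤ q) :
    {x : ℝ × ℝ | Feasible vbar (hyperbolicDemand vbar q p) x.1 x.2} =
      (Icc 0 1 ×ˢ Icc 0 vbar) ∩ ({x | x.1 ≤ q} ∪ {x | x.2 * x.1 ≤ p * q}) := by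
  ext ⟨x, y⟩
  simp only [Feasible, hyperbolicDemand, mem_ofPred_eq, mem_inter_iff, mem_prod, mem_union,
    and_assoc]
  refine and_congr_right fun hx => and_congr_right fun hy => ?_
  split_ifs with h
  · simp [h, hy.2]
  · simp [h, le_div_iff₀ (hq.trans_lt (not_le.mp h))]

theorem exists_bestResponse_hyperbolicDemand {vbar q p : ℝ} {ρ : ℝ → ℝ → ℝ}
    (hρ : IsPolicy vbar ρ) (hq : q ∈ Icc (0:ℝ) 1) (hp : 0 ≤ p) (hpv : p ≤ vbar) :
    ∃ x y, Feasible vbar (hyperbolicDemand vbar q p) x y ∧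
      ∀ x' y', Feasible vbar (hyperbolicDemand vbar q p) x' y' → ρ x' y' ≤ ρ x y := by
  have heq := setOf_feasible_hyperbolicDemand (vbar := vbar) (p := p) hq.1
  have hcl : IsClosed ({x : ℝ × ℝ | x.1 ≤ q} ∪ {x | x.2 * x.1 ≤ p * q}) :=
    (isClosed_le continuous_fst continuous_const).union
      (isClosed_le (continuous_snd.mul continuous_fst) continuous_const)
  have hcomp : IsCompact {x : ℝ × ℝ | Feasible vbar (hyperbolicDemand vbar q p) x.1 x.2} := by
    rw [heq]
    exact (isCompact_Icc.prod isCompact_Icc).inter_right hcl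
  have hne : {x : ℝ × ℝ | Feasible vbar (hyperbolicDemand vbar q p) x.1 x.2}.Nonempty := by
    refine ⟨(0, 0), ?_⟩
    rw [heq]
    exact ⟨⟨⟨le_rfl, zero_le_one⟩, le_rfl, hp.trans hpv⟩, Or.inl hq.1⟩
  have husc := hρ.1.mono (heq.trans_subset inter_subset_left)
  obtain ⟨⟨x, y⟩, hx, hmax⟩ := husc.exists_isMaxOn hne hcomp
  exact ⟨x, y, hx, fun x' y' h => hmax (show (x', y') ∈ {x : ℝ × ℝ | _} from h)⟩

theorem exists_isMaxOn_zero_quantity {vbar : ℝ} {ρ : ℝ → ℝ → ℝ} (hv : 0 ≤ vbar)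
    (hρ : IsPolicy vbar ρ) :
    ∃ y ∈ Icc 0 vbar, 0 ≤ ρ 0 y ∧ ∀ y' ∈ Icc 0 vbar, ρ 0 y' ≤ ρ 0 y := by
  have husc : UpperSemicontinuousOn (fun y => ρ 0 y) (Icc 0 vbar) :=
    hρ.1.comp (g := fun y : ℝ => ((0:ℝ), y)) (by fun_prop)
      fun y hy => ⟨⟨le_rfl, zero_le_one⟩, hy⟩
  obtain ⟨y, hy, hmax⟩ := husc.exists_isMaxOn (nonempty_Icc.mpr hv) isCompact_Icc
  exact ⟨y, hy, hρ.2.trans (hmax ⟨le_rfl, hv⟩), fun y' hy' => hmax hy'⟩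

theorem le_WCRfixed_of_le_RGRT {vbar α x : ℝ} {ρ : ℝ → ℝ → ℝ} {V C : ℝ → ℝ} {q p : ℝ}
    (hV : IsDemand vbar V) (hC : IsFixedCost C) (hbr : BestResponse vbar V C ρ q p)
    (hx : x ≤ RGRT vbar α V C ρ q p) : (x : EReal) ≤ WCRfixed vbar α ρ :=
  (EReal.coe_le_coe_iff.mpr hx).trans (le_sSup ⟨V, C, q, p, hV, hC, hbr, rfl⟩)

theorem regretFn_le_WCRfixed {vbar α : ℝ} (hv : 0 < vbar) (hα : α ∈ Icc (0:ℝ) 1)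
    {ρ : ℝ → ℝ → ℝ} (hρ : IsPolicy vbar ρ) {q p : ℝ} (hq : q ∈ Icc (0:ℝ) 1)
    (hp : p ∈ Icc 0 (kcap vbar α)) :
    ((regretFn vbar α q p : ℝ) : EReal) ≤ WCRfixed vbar α ρ := by
  obtain ⟨hα0, hα1⟩ := hα
  have hk : (2 - α) * kcap vbar α = vbar := mul_div_cancel₀ vbar (by linarith)
  have hk0 : 0 ≤ kcap vbar α := hp.1.trans hp.2
  have hpv : p ≤ vbar := by nlinarith [hp.2]
  have hD := isDemand_hyperbolicDemand hq.1 hp.1 hpv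
  have hint := integral_hyperbolicDemand hq hp.1 hpv
  have hqk : 0 ≤ q * kcap vbar α := mul_nonneg hq.1 hk0
  obtain ⟨x, y, hxy, hmax⟩ := exists_bestResponse_hyperbolicDemand hρ hq hp.1 hpv
  obtain ⟨m, hm, hm0, hmmax⟩ := exists_isMaxOn_zero_quantity hv.le hρ
  rcases le_or_gt (ρ x y) (q * kcap vbar α + ρ 0 m) with hlow | hhigh
  · -- A fixed cost of `q * kcap` deters production.
    have hC := isFixedCost_fixedCost hqk
    refine le_WCRfixed_of_le_RGRT hD hC (q := 0) (p := m)
      ⟨⟨⟨le_rfl, zero_le_one⟩, hm, ?_⟩, ?_⟩ ((min_le_left _ _).trans ?_)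
    · rw [hyperbolicDemand, if_pos hq.1]
      exact hm.2
    · intro x' y' h'
      rw [fixedCost_zero]
      rcases h'.1.1.eq_or_lt with rfl | h0
      · rw [fixedCost_zero]
        linarith [hmmax y' h'.2.1]
      · rw [fixedCost_of_pos h0]
        linarith [hmax x' y' h']
    · have hO := surplus_le_OPT hD hC.1 (q := 1) ⟨zero_le_one, le_rfl⟩
      rw [hint, fixedCost_of_pos one_pos] at hO
      rw [RGRT, intervalIntegral.integral_same, fixedCost_zero]
      nlinarith [mul_nonneg (sub_nonneg.mpr hα1) hm0, congrArg (q * ·) hk]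
  rcases le_or_gt x q with hxq | hqx
  · -- At zero cost the firm underproduces while earning at least `q * kcap`.
    have hC := isFixedCost_fixedCost (le_refl (0:ℝ))
    have hC0 : ∀ z, fixedCost 0 z = 0 := by simp [fixedCost]
    refine le_WCRfixed_of_le_RGRT hD hC (q := x) (p := y) ⟨hxy, ?_⟩ ((min_le_left _ _).trans ?_)
    · intro x' y' h'
      rw [hC0, hC0]
      linarith [hmax x' y' h']
    · have hO := surplus_le_OPT hD hC.1 (q := 1) ⟨zero_le_one, le_rfl⟩
      rw [hint] at hO
      have hle := integral_le_of_forall_mem_Icc (V := hyperbolicDemand vbar q p) (a := vbar)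
        hxy.1.1 fun z hz => hD.2.2 z ⟨hz.1.le, hz.2.trans hxy.1.2⟩
      rw [RGRT]
      rw [hC0] at hO ⊢
      have h1 : (1 - α) * (q * kcap vbar α) ≤ (1 - α) * ρ x y :=
        mul_le_mul_of_nonneg_left (by linarith) (by linarith)
      nlinarith [mul_le_mul_of_nonneg_left hxq hv.le]
  · -- Facing a low step demand, a high-cost firm produces inefficiently for the subsidy.
    have hx0 : 0 < x := hq.1.trans_lt hqx
    have hC := isFixedCost_fixedCost (c := ρ x y - ρ 0 m) (by linarith)
    have hS := isDemand_stepDemand (q := x) hxy.2.1.1 hxy.2.1.2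
    have hyx : y * x ≤ p * q := by
      have h := hxy.2.2
      rwa [hyperbolicDemand, if_neg (not_le.mpr hqx), le_div_iff₀ hx0] at h
    refine le_WCRfixed_of_le_RGRT hS hC (q := x) (p := y)
      ⟨⟨hxy.1, hxy.2.1, ?_⟩, ?_⟩ ((min_le_right _ _).trans ?_)
    · rw [stepDemand, if_neg (not_le.mpr hx0), if_pos le_rfl]
    · intro x' y' h'
      rw [fixedCost_of_pos hx0]
      rcases h'.1.1.eq_or_lt with rfl | h0
      · rw [fixedCost_zero]
        linarith [hmmax y' h'.2.1]
      · rw [fixedCost_of_pos h0]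
        have hle : y' ≤ hyperbolicDemand vbar q p x' := by
          have h := h'.2.2
          rw [stepDemand, if_neg (not_le.mpr h0)] at h
          split_ifs at h with hx'
          · exact h.trans (hxy.2.2.trans (hD.1 h'.1 hxy.1 hx'))
          · exact h.trans (hD.2.2 x' h'.1).1
        linarith [hmax x' y' ⟨h'.1, h'.2.1, hle⟩]
    · have hO := surplus_le_OPT hS hC.1 (q := 0) ⟨le_rfl, zero_le_one⟩
      rw [intervalIntegral.integral_same, fixedCost_zero] at hO
      have hle := integral_le_of_forall_mem_Icc (V := stepDemand vbar x y) (a := y) hx0.le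
        fun z hz => by
          rw [stepDemand, if_neg (not_le.mpr hz.1), if_pos hz.2]
          exact ⟨hxy.2.1.1, le_rfl⟩
      rw [RGRT, fixedCost_of_pos hx0]
      nlinarith [mul_nonneg (sub_nonneg.mpr hα1) hm0]

/-- The lower bound `r_alpha` on the worst-case regret holds already when the
supremum of the regret ranges only over fixed cost functions. -/
theorem worst_case_regret_lower_bound_fixed_costs
    (vbar alpha : ℝ) (hv : 0 < vbar) (halpha : alpha ∈ Icc (0:ℝ) 1)
    (ρ : ℝ → ℝ → ℝ) (hρ : IsPolicy vbar ρ) :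
    ((rbound vbar alpha : ℝ) : EReal) ≤ WCRfixed vbar alpha ρ := by
  have hk0 : 0 ≤ kcap vbar alpha := div_nonneg hv.le (by linarith [halpha.2])
  have key : ∀ x ∈ {x | ∃ q ∈ Icc (0:ℝ) 1, ∃ p ∈ Icc (0:ℝ) (kcap vbar alpha),
      x = regretFn vbar alpha q p}, ((x : ℝ) : EReal) ≤ WCRfixed vbar alpha ρ := by
    rintro _ ⟨q, hq, p, hp, rfl⟩
    exact regretFn_le_WCRfixed hv halpha hρ hq hp
  refine EReal.le_of_forall_lt_iff_le.mp fun z hz => EReal.coe_le_coe_iff.mpr ?_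
  exact csSup_le ⟨_, 0, ⟨le_rfl, zero_le_one⟩, 0, ⟨le_rfl, hk0⟩, rfl⟩ fun x hx =>
    EReal.coe_le_coe_iff.mp ((key x hx).trans hz.le)
end
end

section
/- Let s_α = sup{ q·(k_α − p) : q ∈ [0,1], p ∈ [0,k_α], (1−α)·q·k_α − q·p·log q > r_α } (the supremum of the empty set being 0). For every s with s_α ≤ s ≤ r_α, the policy ρ(q,p) = min( q·k_α , q·p + s ) satisfies WCR(ρ) ≤ r_α; hence, combined with the lower bound, this policy achieves worst-case regret exactly r_α and is optimal. -/
open Real Set MeasureTheory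

noncomputable section

lemma kcap_nonneg {vbar α : ℝ} (hv : 0 < vbar) (hα : α ∈ Icc (0:ℝ) 1) : 0 ≤ kcap vbar α :=
  div_nonneg hv.le (by linarith [hα.2])

lemma two_sub_mul_kcap {vbar α : ℝ} (hα : α ∈ Icc (0:ℝ) 1) : (2 - α) * kcap vbar α = vbar :=
  mul_div_cancel₀ _ (by linarith [hα.2])

lemma kcap_le {vbar α : ℝ} (hv : 0 < vbar) (hα : α ∈ Icc (0:ℝ) 1) : kcap vbar α ≤ vbar := by
  nlinarith [kcap_nonneg hv hα, two_sub_mul_kcap (vbar := vbar) hα, hα.2]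

lemma mul_sub_le_of_mem {k q p : ℝ} (hq : q ∈ Icc (0:ℝ) 1) (hp : p ∈ Icc (0:ℝ) k) :
    q * (k - p) ≤ k := by
  nlinarith [hq.1, hq.2, hp.1, hp.2]

lemma regretFn_le_rbound {vbar α q p : ℝ} (hq : q ∈ Icc (0:ℝ) 1)
    (hp : p ∈ Icc (0:ℝ) (kcap vbar α)) : regretFn vbar α q p ≤ rbound vbar α := by
  refine le_csSup ⟨kcap vbar α, ?_⟩ ⟨q, hq, p, hp, rfl⟩
  rintro x ⟨q, hq, p, hp, rfl⟩
  exact (min_le_right _ _).trans (mul_sub_le_of_mem hq hp)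

lemma rbound_le_kcap {vbar α : ℝ} (hv : 0 < vbar) (hα : α ∈ Icc (0:ℝ) 1) :
    rbound vbar α ≤ kcap vbar α := by
  refine Real.sSup_le ?_ (kcap_nonneg hv hα)
  rintro x ⟨q, hq, p, hp, rfl⟩
  exact (min_le_right _ _).trans (mul_sub_le_of_mem hq hp)

lemma mul_kcap_le_rbound {vbar α q : ℝ} (hv : 0 < vbar) (hα : α ∈ Icc (0:ℝ) 1)
    (hq : q ∈ Icc (0:ℝ) 1) : (1 - α) * q * kcap vbar α ≤ rbound vbar α := by
  have hk := kcap_nonneg hv hα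
  refine le_trans ?_ (regretFn_le_rbound hq ⟨le_rfl, hk⟩)
  refine le_min (by simp) ?_
  nlinarith [mul_nonneg hα.1 (mul_nonneg hq.1 hk)]

lemma sbound_nonneg (vbar α : ℝ) : 0 ≤ sbound vbar α := by
  refine Real.sSup_nonneg ?_
  rintro x ⟨q, hq, p, hp, -, rfl⟩
  exact mul_nonneg hq.1 (sub_nonneg.2 hp.2)

lemma mul_sub_le_sbound {vbar α q p : ℝ} (hq : q ∈ Icc (0:ℝ) 1)
    (hp : p ∈ Icc (0:ℝ) (kcap vbar α))
    (h : rbound vbar α < (1 - α) * q * kcap vbar α - q * p * Real.log q) :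
    q * (kcap vbar α - p) ≤ sbound vbar α := by
  refine le_csSup ⟨kcap vbar α, ?_⟩ ⟨q, hq, p, hp, h, rfl⟩
  rintro x ⟨q, hq, p, hp, -, rfl⟩
  exact mul_sub_le_of_mem hq hp

/-- Once the subsidy is at least `sbound`, the underproduction regret is controlled by `rbound`. -/
lemma underproduction_le_rbound {vbar α s q : ℝ} (hv : 0 < vbar) (hα : α ∈ Icc (0:ℝ) 1)
    (hs : sbound vbar α ≤ s) (hq0 : 0 < q) (hq1 : q ≤ 1) (hsq : s ≤ q * kcap vbar α) :
    (1 - α) * q * kcap vbar α - (q * kcap vbar α - s) * Real.log q ≤ rbound vbar α := by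
  rcases hsq.eq_or_lt with rfl | hlt
  · simpa using mul_kcap_le_rbound hv hα ⟨hq0.le, hq1⟩
  by_contra! hcon
  have hcont : Continuous fun t : ℝ =>
      (1 - α) * q * kcap vbar α - (q * kcap vbar α - t) * Real.log q := by fun_prop
  have h1 : ∀ᶠ t in nhdsWithin s (Ioi s),
      rbound vbar α < (1 - α) * q * kcap vbar α - (q * kcap vbar α - t) * Real.log q :=
    (hcont.continuousAt.eventually (lt_mem_nhds hcon)).filter_mono nhdsWithin_le_nhds
  obtain ⟨t, ht, hts⟩ := (h1.and (Ioo_mem_nhdsGT hlt)).exists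
  have hs0 := (sbound_nonneg vbar α).trans hs
  have heq : q * (kcap vbar α - t / q) = q * kcap vbar α - t := by field_simp
  have hp : kcap vbar α - t / q ∈ Icc (0:ℝ) (kcap vbar α) := by
    constructor
    · rw [sub_nonneg, div_le_iff₀ hq0, mul_comm]
      exact hts.2.le
    · linarith [div_nonneg (hs0.trans hts.1.le) hq0.le]
  have h2 := mul_sub_le_sbound (q := q) ⟨hq0.le, hq1⟩ hp (by rwa [heq])
  have h3 : q * (kcap vbar α - (kcap vbar α - t / q)) = t := by field_simp; ring
  linarith [hts.1]

lemma IsDemand.intervalIntegrable {vbar a b : ℝ} {V : ℝ → ℝ} (hV : IsDemand vbar V)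
    (ha : a ∈ Icc (0:ℝ) 1) (hb : b ∈ Icc (0:ℝ) 1) : IntervalIntegrable V volume a b :=
  (hV.1.mono (uIcc_subset_Icc ha hb)).intervalIntegrable

lemma IsDemand.integral_le {vbar a b : ℝ} {V : ℝ → ℝ} (hV : IsDemand vbar V)
    (ha : 0 ≤ a) (hab : a ≤ b) (hb : b ≤ 1) : ∫ z in a..b, V z ≤ (b - a) * vbar := by
  have h := intervalIntegral.integral_mono_on hab
    (hV.intervalIntegrable ⟨ha, hab.trans hb⟩ ⟨ha.trans hab, hb⟩)
    (intervalIntegrable_const (c := vbar))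
    fun z hz => (hV.2.2 z ⟨ha.trans hz.1, hz.2.trans hb⟩).2
  simpa using h

lemma IsDemand.le_OPT {vbar q : ℝ} {V C : ℝ → ℝ} (hV : IsDemand vbar V) (hC : IsCost C)
    (hv : 0 < vbar) (hq : q ∈ Icc (0:ℝ) 1) : (∫ z in (0:ℝ)..q, V z) - C q ≤ OPT V C := by
  refine le_csSup ⟨vbar, ?_⟩ ⟨q, hq, rfl⟩
  rintro x ⟨q, hq, rfl⟩
  nlinarith [hV.integral_le le_rfl hq.1 hq.2, hC.2.2.1 q hq, hq.2]

/-- Regret against an efficient quantity `w` above the quantity `q` chosen by the firm. -/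
lemma regret_le_of_le {vbar α s q p w : ℝ} {V C : ℝ → ℝ} (hv : 0 < vbar)
    (hα : α ∈ Icc (0:ℝ) 1) (hs : sbound vbar α ≤ s) (hV : IsDemand vbar V) (hC : IsCost C)
    (hB : BestResponse vbar V C (fun q p => min (q * kcap vbar α) (q * p + s)) q p)
    (hqw : q ≤ w) (hw : w ≤ 1) :
    (∫ z in q..w, V z) - (C w - C q) +
      (1 - α) * (min (q * kcap vbar α) (q * p + s) - C q) ≤ rbound vbar α := by
  obtain ⟨⟨hq, -, -⟩, hmax⟩ := hB
  have hk := kcap_nonneg hv hα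
  have hvk := two_sub_mul_kcap (vbar := vbar) hα
  have hs0 := (sbound_nonneg vbar α).trans hs
  have hα1 : 0 ≤ 1 - α := by linarith [hα.2]
  set k := kcap vbar α with hkdef
  have hkpos : 0 < k := div_pos hv (by linarith [hα.2])
  have hw' : w ∈ Icc (0:ℝ) 1 := ⟨hq.1.trans hqw, hw⟩
  have hD : C q ≤ C w := hC.1 hq hw' hqw
  have hCq := hC.2.2.1 q hq
  have hprofit : (1 - α) * (min (q * k) (q * p + s) - C q) ≤ (1 - α) * (q * k) :=
    mul_le_mul_of_nonneg_left (by linarith [min_le_left (q * k) (q * p + s)]) hα1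
  -- `q'` is the quantity whose capped revenue `q' * k` covers the extra cost of producing `w`
  obtain ⟨q', hq'⟩ : ∃ q', q' * k = q * k + (C w - C q) :=
    ⟨(q * k + (C w - C q)) / k, div_mul_cancel₀ _ hkpos.ne'⟩
  have hqq' : q ≤ q' := by
    by_contra! h
    nlinarith
  have hresp : ∀ z, q ≤ z → z ≤ w → min (z * k) (z * V z + s) ≤ q' * k := by
    intro z hqz hzw
    have hz : z ∈ Icc (0:ℝ) 1 := ⟨hq.1.trans hqz, hzw.trans hw⟩
    have h := hmax z (V z) ⟨hz, hV.2.2 z hz, le_rfl⟩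
    simp only at h
    have hCz := hC.1 hz hw' hzw
    linarith [min_le_left (q * k) (q * p + s)]
  rcases le_or_gt w q' with hwq' | hwq'
  · have hint := hV.integral_le hq.1 hqw hw
    have := mul_kcap_le_rbound hv hα hw'
    rw [← hkdef] at this
    rw [← hvk] at hint
    have : w * k ≤ q' * k := mul_le_mul_of_nonneg_right hwq' hk
    nlinarith
  have hresp' : ∀ z, q' < z → z ≤ w → z * V z + s ≤ q' * k := by
    intro z hz hzw
    rcases min_le_iff.1 (hresp z (hqq'.trans hz.le) hzw) with h | h
    · nlinarith
    · exact h
  have hq'mem : q' ∈ Icc (0:ℝ) 1 := ⟨hq.1.trans hqq', hwq'.le.trans hw⟩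
  have hsq' : s ≤ q' * k := by
    have := hresp' w hwq' le_rfl
    nlinarith [mul_nonneg hw'.1 (hV.2.2 w hw').1]
  have hsplit : (∫ z in q..w, V z) = (∫ z in q..q', V z) + ∫ z in q'..w, V z :=
    (intervalIntegral.integral_add_adjacent_intervals (hV.intervalIntegrable hq hq'mem)
      (hV.intervalIntegrable hq'mem hw')).symm
  have hint := hV.integral_le hq.1 hqq' hq'mem.2
  have htail : ∫ z in q'..w, V z ≤ -(q' * k - s) * Real.log q' := by
    rcases hq'mem.1.eq_or_lt with h0 | h0
    · have h := intervalIntegral.integral_mono_on_of_le_Ioo hwq'.le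
        (hV.intervalIntegrable hq'mem hw') (intervalIntegrable_const (c := (0:ℝ)))
        fun z hz => by
          have h1 := hresp' z hz.1 hz.2.le
          rw [← h0] at h1
          have hz0 : 0 < z := by linarith [hz.1]
          by_contra! h2
          nlinarith [mul_pos hz0 h2]
      simpa [← h0] using h
    · have hne : (0:ℝ) ∉ uIcc q' w := by
        rw [uIcc_of_le hwq'.le]
        exact fun h => absurd h.1 (not_le.2 h0)
      have hii : IntervalIntegrable (fun z : ℝ => z⁻¹) volume q' w :=
        intervalIntegral.intervalIntegrable_inv (fun z hz h => hne (h ▸ hz)) continuousOn_id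
      have h := intervalIntegral.integral_mono_on_of_le_Ioo hwq'.le
        (hV.intervalIntegrable hq'mem hw') (hii.const_mul (q' * k - s))
        fun z hz => by
          have h1 := hresp' z hz.1 hz.2.le
          rw [← div_eq_mul_inv, le_div_iff₀ (h0.trans hz.1)]
          linarith
      rw [intervalIntegral.integral_const_mul, integral_inv hne,
        Real.log_div (h0.trans hwq').ne' h0.ne'] at h
      nlinarith [Real.log_nonpos hw'.1 hw]
  have hfin : (1 - α) * q' * k - (q' * k - s) * Real.log q' ≤ rbound vbar α := by
    rcases hq'mem.1.eq_or_lt with h0 | h0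
    · have := mul_kcap_le_rbound hv hα hq'mem
      simpa [← h0] using this
    · exact underproduction_le_rbound hv hα hs h0 hq'mem.2 hsq'
  rw [← hvk] at hint
  nlinarith

/-- Regret against an efficient quantity `w` below the quantity `q` chosen by the firm. -/
lemma regret_le_of_ge {vbar α s q p w : ℝ} {V C : ℝ → ℝ} (hv : 0 < vbar)
    (hα : α ∈ Icc (0:ℝ) 1) (hs0 : 0 ≤ s) (hs' : s ≤ rbound vbar α)
    (hV : IsDemand vbar V) (hC : IsCost C)
    (hB : BestResponse vbar V C (fun q p => min (q * kcap vbar α) (q * p + s)) q p)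
    (hw0 : 0 ≤ w) (hwq : w ≤ q) :
    -(∫ z in w..q, V z) - (C w - C q) +
      (1 - α) * (min (q * kcap vbar α) (q * p + s) - C q) ≤ rbound vbar α := by
  obtain ⟨⟨hq, hp, hpV⟩, hmax⟩ := hB
  have hk := kcap_nonneg hv hα
  have hα1 : 0 ≤ 1 - α := by linarith [hα.2]
  have hr := fun x hx => mul_kcap_le_rbound (q := x) hv hα hx
  set k := kcap vbar α with hkdef
  have hw : w ∈ Icc (0:ℝ) 1 := ⟨hw0, hwq.trans hq.2⟩
  have hint : (q - w) * p ≤ ∫ z in w..q, V z := by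
    have h := intervalIntegral.integral_mono_on hwq (intervalIntegrable_const (c := p))
      (hV.intervalIntegrable hw hq)
      fun z hz => hpV.trans (hV.1 ⟨hw0.trans hz.1, hz.2.trans hq.2⟩ hq hz.2)
    simpa using h
  have hF := hmax 0 0 ⟨⟨le_rfl, zero_le_one⟩, ⟨le_rfl, hv.le⟩, (hV.2.2 0 (by simp)).1⟩
  have hdev := hmax w p ⟨hw, hp, hpV.trans (hV.1 hw hq hwq)⟩
  simp only [zero_mul, zero_add, hC.2.2.2, min_eq_left hs0, sub_zero] at hF hdev
  have hCw := hC.2.2.1 w hw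
  have hρk := min_le_left (q * k) (q * p + s)
  have hρp := min_le_right (q * k) (q * p + s)
  set ρ := min (q * k) (q * p + s)
  have hαF : α * min (w * k) (w * p + s) ≤ α * (ρ - C q) + C w := by
    nlinarith [mul_le_mul_of_nonneg_left hdev hα.1, mul_nonneg hα1 hCw]
  rcases le_total (w * p + s) (w * k) with h | h
  · rw [min_eq_right h] at hαF
    nlinarith [hr w hw, mul_le_mul_of_nonneg_left h hα1]
  rw [min_eq_left h] at hαF
  rcases le_total p (α * k) with hpk | hpk
  · nlinarith [mul_nonneg hw0 (sub_nonneg.2 hpk)]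
  rcases le_or_gt (q * (k - p)) s with hsq | hsq
  · nlinarith [hr q hq, mul_nonneg (sub_nonneg.2 hwq) (sub_nonneg.2 hpk)]
  have hkp : 0 < k - p := by
    by_contra! hkp
    nlinarith [hq.1]
  obtain ⟨x, hx⟩ : ∃ x, x * (k - p) = s := ⟨s / (k - p), div_mul_cancel₀ _ hkp.ne'⟩
  have hwx : w ≤ x := by
    by_contra! hcon
    nlinarith
  have hxq : x ≤ q := by
    by_contra! hcon
    nlinarith
  nlinarith [hr x ⟨hw0.trans hwx, hxq.trans hq.2⟩,
    mul_nonneg (sub_nonneg.2 hwx) (sub_nonneg.2 hpk)]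

lemma WCR_le_rbound {vbar α s : ℝ} (hv : 0 < vbar) (hα : α ∈ Icc (0:ℝ) 1)
    (hs : sbound vbar α ≤ s) (hs' : s ≤ rbound vbar α) :
    WCR vbar α (fun q p => min (q * kcap vbar α) (q * p + s)) ≤ ((rbound vbar α : ℝ) : EReal) := by
  refine sSup_le ?_
  rintro _ ⟨V, C, q, p, hV, hC, hB, rfl⟩
  rw [EReal.coe_le_coe_iff]
  have hq := hB.1.1
  have h0 : (0:ℝ) ∈ Icc (0:ℝ) 1 := by simp
  suffices OPT V C ≤ rbound vbar α + ((∫ z in (0:ℝ)..q, V z) - C q) -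
      (1 - α) * (min (q * kcap vbar α) (q * p + s) - C q) by
    unfold RGRT
    linarith
  refine csSup_le ⟨_, 0, h0, rfl⟩ ?_
  rintro _ ⟨w, hw, rfl⟩
  rcases le_total q w with hqw | hwq
  · have h := regret_le_of_le hv hα hs hV hC hB hqw hw.2
    have := intervalIntegral.integral_add_adjacent_intervals (hV.intervalIntegrable h0 hq)
      (hV.intervalIntegrable hq hw)
    linarith
  · have h := regret_le_of_ge hv hα ((sbound_nonneg _ _).trans hs) hs' hV hC hB hw.1 hwq
    have := intervalIntegral.integral_add_adjacent_intervals (hV.intervalIntegrable h0 hw)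
      (hV.intervalIntegrable hw hq)
    linarith

lemma le_WCR {vbar α q p : ℝ} {V C : ℝ → ℝ} {ρ : ℝ → ℝ → ℝ} (hV : IsDemand vbar V)
    (hC : IsCost C) (hB : BestResponse vbar V C ρ q p) :
    ((RGRT vbar α V C ρ q p : ℝ) : EReal) ≤ WCR vbar α ρ :=
  le_sSup ⟨V, C, q, p, hV, hC, hB, rfl⟩

lemma isCost_fixed {s : ℝ} (hs : 0 ≤ s) : IsCost fun z => if 0 < z then s else 0 := by
  refine ⟨?_, ?_, ?_, by simp⟩
  · intro a _ b _ hab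
    dsimp only
    split_ifs with h1 h2 <;> first | exact le_rfl | exact hs | linarith
  · intro x hx y hy
    dsimp only at hy
    split_ifs at hy with h
    · filter_upwards [nhdsWithin_le_nhds (lt_mem_nhds h)] with z hz
      simpa [hz] using hy
    · refine Filter.Eventually.of_forall fun z => ?_
      dsimp only
      split_ifs <;> linarith
  · intro z _
    dsimp only
    split_ifs <;> linarith

/-- The firm may waste the whole subsidy on a worthless good. -/
lemma subsidy_le_WCR {vbar α s : ℝ} (hv : 0 < vbar) (hs : 0 ≤ s) (hsk : s ≤ kcap vbar α) :
    (s : EReal) ≤ WCR vbar α (fun q p => min (q * kcap vbar α) (q * p + s)) := by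
  have hV : IsDemand vbar fun _ => 0 :=
    ⟨antitoneOn_const, upperSemicontinuousOn_const, fun _ _ => ⟨le_rfl, hv.le⟩⟩
  have hC := isCost_fixed hs
  have hB : BestResponse vbar (fun _ => 0) (fun z => if 0 < z then s else 0)
      (fun q p => min (q * kcap vbar α) (q * p + s)) 1 0 := by
    refine ⟨⟨by simp, ⟨le_rfl, hv.le⟩, le_rfl⟩, ?_⟩
    rintro q p ⟨hq, hp, hp0⟩
    obtain rfl : p = 0 := le_antisymm hp0 hp.1
    rcases hq.1.eq_or_lt with rfl | h
    · simp [hsk, hs]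
    · simp [hsk, h]
  refine le_trans ?_ (le_WCR hV hC hB)
  have h := hV.le_OPT hC hv (q := 0) (by simp)
  rw [EReal.coe_le_coe_iff]
  simp only [intervalIntegral.integral_same, lt_irrefl, if_false, sub_zero] at h
  simp only [RGRT, intervalIntegral.integral_zero, zero_lt_one, if_true, one_mul, mul_zero,
    zero_add, min_eq_right hsk]
  linarith

/-- Demand that is maximal up to `q` and has constant revenue `q * p` beyond `q`. -/
lemma isDemand_hyperbolic {vbar q p : ℝ} (hq : 0 < q) (hp : 0 ≤ p) (hpv : p ≤ vbar) :
    IsDemand vbar fun z => if z ≤ q then vbar else q * p / z := by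
  have hmem : ∀ z ∈ Icc (0:ℝ) 1, (if z ≤ q then vbar else q * p / z) ∈ Icc 0 vbar := by
    intro z hz
    split_ifs with h
    · exact ⟨hp.trans hpv, le_rfl⟩
    · push Not at h
      refine ⟨div_nonneg (mul_nonneg hq.le hp) hz.1, ?_⟩
      rw [div_le_iff₀ (hq.trans h)]
      nlinarith
  refine ⟨?_, ?_, hmem⟩
  · intro a ha b hb hab
    dsimp only
    by_cases h : a ≤ q
    · rw [if_pos h]
      exact (hmem b hb).2
    · rw [if_neg h, if_neg (by linarith)]
      push Not at h
      exact div_le_div_of_nonneg_left (mul_nonneg hq.le hp) (hq.trans h) hab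
  · intro x hx y hy
    dsimp only at hy
    by_cases h : x ≤ q
    · rw [if_pos h] at hy
      filter_upwards [self_mem_nhdsWithin] with z hz
      exact (hmem z hz).2.trans_lt hy
    · rw [if_neg h] at hy
      push Not at h
      have hcont : ContinuousAt (fun z : ℝ => q * p / z) x :=
        continuousAt_const.div continuousAt_id (hq.trans h).ne'
      filter_upwards [nhdsWithin_le_nhds (lt_mem_nhds h),
        nhdsWithin_le_nhds (hcont.eventually (gt_mem_nhds hy))] with z hz hzy
      rwa [if_neg (not_le.2 hz)]

/-- The firm may stop at `q` although the remaining consumers are valuable. -/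
lemma underproduction_le_WCR {vbar α s q p : ℝ} (hv : 0 < vbar) (hα : α ∈ Icc (0:ℝ) 1)
    (hs : 0 ≤ s) (hq0 : 0 < q) (hq1 : q ≤ 1) (hp : p ∈ Icc (0:ℝ) (kcap vbar α))
    (hsq : s ≤ q * (kcap vbar α - p)) :
    (((1 - α) * q * kcap vbar α - q * p * Real.log q : ℝ) : EReal) ≤
      WCR vbar α (fun q p => min (q * kcap vbar α) (q * p + s)) := by
  have hk := kcap_nonneg hv hα
  have hkv := kcap_le hv hα
  have hV := isDemand_hyperbolic hq0 hp.1 (hp.2.trans hkv)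
  have hC : IsCost fun _ => 0 :=
    ⟨monotoneOn_const, lowerSemicontinuousOn_const, fun _ _ => le_rfl, rfl⟩
  have hcap : min (q * kcap vbar α) (q * vbar + s) = q * kcap vbar α :=
    min_eq_left (by nlinarith)
  set V : ℝ → ℝ := fun z => if z ≤ q then vbar else q * p / z with hVdef
  have hqmem : q ∈ Icc (0:ℝ) 1 := ⟨hq0.le, hq1⟩
  have h1mem : (1:ℝ) ∈ Icc (0:ℝ) 1 := by simp
  have hB : BestResponse vbar V (fun _ => 0)
      (fun q p => min (q * kcap vbar α) (q * p + s)) q vbar := by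
    refine ⟨⟨hqmem, ⟨hv.le, le_rfl⟩, by simp [hVdef]⟩, ?_⟩
    rintro x y ⟨hx, hy, hxy⟩
    simp only [hcap, sub_zero]
    rcases le_or_gt x q with h | h
    · exact (min_le_left _ _).trans (mul_le_mul_of_nonneg_right h hk)
    · refine (min_le_right _ _).trans ?_
      simp only [hVdef, if_neg (not_le.2 h)] at hxy
      rw [le_div_iff₀ (hq0.trans h)] at hxy
      linarith
  refine le_trans ?_ (le_WCR hV hC hB)
  rw [EReal.coe_le_coe_iff]
  have hopt := hV.le_OPT hC hv h1mem
  have hsplit := intervalIntegral.integral_add_adjacent_intervals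
    (hV.intervalIntegrable (a := 0) (by simp) hqmem) (hV.intervalIntegrable hqmem h1mem)
  have hne : (0:ℝ) ∉ uIcc q 1 := by
    rw [uIcc_of_le hq1]
    exact fun h => absurd h.1 (not_le.2 hq0)
  have hii : IntervalIntegrable (fun z : ℝ => z⁻¹) volume q 1 :=
    intervalIntegral.intervalIntegrable_inv (fun z hz h => hne (h ▸ hz)) continuousOn_id
  have hlow := intervalIntegral.integral_mono_on_of_le_Ioo hq1 (hii.const_mul (q * p))
    (hV.intervalIntegrable hqmem h1mem) fun z hz => by
      simp [hVdef, not_le.2 hz.1, div_eq_mul_inv]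
  rw [intervalIntegral.integral_const_mul, integral_inv hne, one_div, Real.log_inv] at hlow
  simp only [RGRT, hcap]
  linarith

lemma rbound_le_WCR {vbar α s : ℝ} (hv : 0 < vbar) (hα : α ∈ Icc (0:ℝ) 1)
    (hs : 0 ≤ s) (hs' : s ≤ rbound vbar α) :
    ((rbound vbar α : ℝ) : EReal) ≤ WCR vbar α (fun q p => min (q * kcap vbar α) (q * p + s)) := by
  have hsub := subsidy_le_WCR hv hs (hs'.trans (rbound_le_kcap hv hα))
  refine le_of_forall_lt fun c hc => ?_
  obtain ⟨x, hcx, hx⟩ := EReal.lt_iff_exists_real_btwn.1 hc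
  rw [EReal.coe_lt_coe_iff] at hx
  refine hcx.trans_le ?_
  obtain ⟨_, ⟨q, hq, p, hp, rfl⟩, hxy⟩ := exists_lt_of_lt_csSup
    (by exact ⟨_, 0, by simp, 0, ⟨le_rfl, kcap_nonneg hv hα⟩, rfl⟩) hx
  refine le_trans (EReal.coe_le_coe_iff.2 hxy.le) ?_
  rcases le_or_gt s (q * (kcap vbar α - p)) with h | h
  · rcases hq.1.eq_or_lt with rfl | hq0
    · refine le_trans (EReal.coe_le_coe_iff.2 ?_) hsub
      simpa [regretFn] using hs
    · exact (EReal.coe_le_coe_iff.2 (min_le_left _ _)).trans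
        (underproduction_le_WCR hv hα hs hq0 hq.2 hp h)
  · exact (EReal.coe_le_coe_iff.2 ((min_le_right _ _).trans h.le)).trans hsub

/-- **Theorem 2, optimal policy.** For every `s` with `s_alpha ≤ s ≤ r_alpha`,
the policy `ρ (q, p) = min (q * k_alpha) (q * p + s)` has worst-case regret at most `r_alpha`;
hence, combined with the lower bound, it achieves worst-case regret exactly `r_alpha`. -/
theorem optimal_policy_achieves_rbound
    (vbar alpha : ℝ) (hv : 0 < vbar) (halpha : alpha ∈ Icc (0:ℝ) 1)
    (s : ℝ) (hs : sbound vbar alpha ≤ s) (hs' : s ≤ rbound vbar alpha) :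
    WCR vbar alpha (fun q p => min (q * kcap vbar alpha) (q * p + s)) ≤
        ((rbound vbar alpha : ℝ) : EReal) ∧
      WCR vbar alpha (fun q p => min (q * kcap vbar alpha) (q * p + s)) =
        ((rbound vbar alpha : ℝ) : EReal) := by
  have hle := WCR_le_rbound hv halpha hs hs'
  exact ⟨hle, hle.antisymm (rbound_le_WCR hv halpha ((sbound_nonneg _ _).trans hs) hs')⟩
end
end
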